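/- For every prime p > 7, the number 2 · 3^2 · 7^{⌊(p−1)/6⌋} · p is a primitive covering number. -/

import Mathlib

/-- A positive integer `n` is a *covering number* if there is a finite system of
residue classes `aᵢ (mod mᵢ)` covering all of `ℤ`, whose moduli `mᵢ` are distinct,
all greater than `1`, and all divide `n`. -/
def IsCoveringNumber (n : ℕ) : Prop :=
  ∃ (k : ℕ) (a : Fin k → ℤ) (m : Fin k → ℕ),
    Function.Injective m ∧
    (∀ i, 1 < m i) ∧ (∀ i, m i ∣ n) ∧
    (∀ x : ℤ, ∃ i, (m i : ℤ) ∣ x - a i)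

/-- A covering number is *primitive* if none of its proper divisors is a covering number. -/
def IsPrimitiveCoveringNumber (n : ℕ) : Prop :=
  IsCoveringNumber n ∧ ∀ d : ℕ, d ∣ n → d ≠ n → ¬ IsCoveringNumber d

/-- The residue class system `{a d (mod d) : d ∣ n, d > 1}` covers the integer `x`. -/
def CoversAt (a : ℕ → ℤ) (n : ℕ) (x : ℤ) : Prop :=
  ∃ d : ℕ, d ∣ n ∧ 1 < d ∧ (d : ℤ) ∣ x - a d

/-- Some choice of residues for the divisors of `n` greater than `1` covers every integer
outside a single residue class modulo `n`. -/
def AlmostCovers (n : ℕ) : Prop :=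
  ∃ (a : ℕ → ℤ) (r : ℤ), ∀ x : ℤ, CoversAt a n x ∨ (n : ℤ) ∣ x - r

/-- The divisors of `n * q` that do not divide `n`. -/
def newDivisors (n q : ℕ) : Finset ℕ :=
  (n * q).divisors \ n.divisors

lemma isCoveringNumber_iff {n : ℕ} (hn : n ≠ 0) :
    IsCoveringNumber n ↔ ∃ a : ℕ → ℤ, ∀ x, CoversAt a n x := by
  constructor
  · rintro ⟨k, a, m, hinj, h1, hdvd, hcov⟩
    refine ⟨Function.extend m a 0, fun x => ?_⟩
    obtain ⟨i, hi⟩ := hcov x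
    exact ⟨m i, hdvd i, h1 i, by rwa [hinj.extend_apply]⟩
  · rintro ⟨a, ha⟩
    let S := n.divisors.filter (1 < ·)
    have hS (d : S) : (d : ℕ) ∣ n ∧ 1 < (d : ℕ) := by
      obtain ⟨hd, h1⟩ := Finset.mem_filter.1 d.2
      exact ⟨Nat.dvd_of_mem_divisors hd, h1⟩
    refine ⟨S.card, fun i => a (S.equivFin.symm i), fun i => (S.equivFin.symm i : ℕ),
      Subtype.val_injective.comp S.equivFin.symm.injective,
      fun i => (hS _).2, fun i => (hS _).1, fun x => ?_⟩
    obtain ⟨d, hd, h1, hx⟩ := ha x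
    have hmem : d ∈ S := Finset.mem_filter.2 ⟨Nat.mem_divisors.2 ⟨hd, hn⟩, h1⟩
    exact ⟨S.equivFin ⟨d, hmem⟩, by simpa using hx⟩

lemma IsCoveringNumber.of_dvd {m n : ℕ} (h : IsCoveringNumber m) (hmn : m ∣ n) :
    IsCoveringNumber n := by
  obtain ⟨k, a, d, hinj, h1, hdvd, hcov⟩ := h
  exact ⟨k, a, d, hinj, h1, fun i => (hdvd i).trans hmn, hcov⟩

lemma mem_newDivisors {n q d : ℕ} (hn : n ≠ 0) (hq : q ≠ 0) :
    d ∈ newDivisors n q ↔ d ∣ n * q ∧ ¬ d ∣ n := by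
  simp [newDivisors, hn, hq]

lemma card_newDivisors {m q : ℕ} (hm : m ≠ 0) (hq : q.Prime) (hmq : m.Coprime q) (e : ℕ) :
    (newDivisors (m * q ^ e) q).card = m.divisors.card := by
  have hsub : (m * q ^ e).divisors ⊆ (m * q ^ e * q).divisors :=
    Nat.divisors_subset_of_dvd (by simp [hm, hq.ne_zero]) (Dvd.intro _ rfl)
  have hcard (j : ℕ) : (m * q ^ j).divisors.card = m.divisors.card * (j + 1) := by
    rw [(hmq.pow_right j).card_divisors_mul, Nat.divisors_prime_pow hq, Finset.card_map,
      Finset.card_range]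
  rw [newDivisors, Finset.card_sdiff_of_subset hsub, mul_assoc, ← pow_succ, hcard, hcard, mul_add,
    mul_one, Nat.add_sub_cancel_left]

/-- The translates `r + n s` with `0 ≤ s < q` of an uncovered integer `r` stay uncovered by the
divisors of `n`, and each new divisor covers at most one of them. -/
lemma exists_not_coversAt_mul {n q : ℕ} (hn : n ≠ 0) (hq : q.Prime)
    (hcard : (newDivisors n q).card < q) {a : ℕ → ℤ} (h : ∃ x, ¬ CoversAt a n x) :
    ∃ x, ¬ CoversAt a (n * q) x := by
  obtain ⟨r, hr⟩ := h
  by_contra! hcov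
  have hnew (s : ℕ) : ∃ d ∈ newDivisors n q, (d : ℤ) ∣ r + n * s - a d := by
    obtain ⟨d, hd, h1, hx⟩ := hcov (r + n * s)
    refine ⟨d, (mem_newDivisors hn hq.ne_zero).2 ⟨hd, fun hdn => hr ⟨d, hdn, h1, ?_⟩⟩, hx⟩
    obtain ⟨u, hu⟩ := hx
    obtain ⟨v, hv⟩ := (Int.natCast_dvd_natCast.2 hdn).mul_right (s : ℤ)
    exact ⟨u - v, by linear_combination hu - hv⟩
  choose f hf hfd using hnew
  obtain ⟨s, hs, t, ht, hst, hfst⟩ := Finset.exists_ne_map_eq_of_card_lt_of_maps_to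
    (s := Finset.range q) (t := newDivisors n q) (f := f) (by simpa using hcard)
    (fun s _ => hf s)
  obtain ⟨hd, hdn⟩ := (mem_newDivisors hn hq.ne_zero).1 (hf s)
  have hdvd : (f s : ℤ) ∣ n * ((s : ℤ) - t) := by
    obtain ⟨u, hu⟩ := hfd s
    obtain ⟨v, hv⟩ := hfd t
    rw [← hfst] at hv
    exact ⟨u - v, by linear_combination hu - hv⟩
  have hcop : IsCoprime ((s : ℤ) - t) q := by
    refine ((Nat.prime_iff_prime_int.1 hq).coprime_iff_not_dvd.2 fun hqd => hst ?_).symm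
    rw [Finset.mem_range] at hs ht
    have h0 := Int.eq_zero_of_abs_lt_dvd hqd (by rw [abs_lt]; omega)
    omega
  obtain ⟨u, v, huv⟩ := hcop
  apply hdn
  rw [← Int.natCast_dvd_natCast]
  have hd' : (f s : ℤ) ∣ (n : ℤ) * q := by exact_mod_cast hd
  obtain ⟨w, hw⟩ := hdvd
  obtain ⟨z, hz⟩ := hd'
  exact ⟨u * w + v * z, by linear_combination u * hw + v * hz - (n : ℤ) * huv⟩

/-- The new divisors of `n * q` cover as many of the `q` classes modulo `n * q` inside the
exceptional class modulo `n` as there are new divisors. -/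
lemma AlmostCovers.exists_mul {n q : ℕ} (hn : n ≠ 0) (hq : q ≠ 0) (h : AlmostCovers n)
    (hcard : q ≤ (newDivisors n q).card + 1) :
    ∃ (a : ℕ → ℤ) (r : ℤ), ∀ x : ℤ, CoversAt a (n * q) x ∨
      ((n * q : ℕ) : ℤ) ∣ x - r ∧ (newDivisors n q).card < q := by
  obtain ⟨a, r, ha⟩ := h
  let S := newDivisors n q
  let b : ℕ → ℤ := fun d => if h : d ∈ S then r + n * ((S.equivFin ⟨d, h⟩ : ℕ) + 1) else a d
  have hqz : (q : ℤ) ≠ 0 := by exact_mod_cast hq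
  refine ⟨b, r, fun x => ?_⟩
  rcases ha x with ⟨d, hd, h1, hx⟩ | ⟨y, hy⟩
  · have hdS : d ∉ S := fun hmem => ((mem_newDivisors hn hq).1 hmem).2 hd
    exact Or.inl ⟨d, hd.mul_right q, h1, by simpa [b, hdS] using hx⟩
  · obtain ⟨s, hs⟩ := Int.eq_ofNat_of_zero_le (Int.emod_nonneg (y - 1) hqz)
    have hsq : s < q := by
      have := Int.emod_lt_of_pos (y - 1) (show (0 : ℤ) < q by omega)
      omega
    have hdiv := Int.mul_ediv_add_emod (y - 1) q
    rw [hs] at hdiv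
    by_cases hsS : s < S.card
    · let d := S.equivFin.symm ⟨s, hsS⟩
      obtain ⟨hd, hdn⟩ := (mem_newDivisors hn hq).1 d.2
      have hbd : b d = r + n * (s + 1) := by simp [b, d]
      refine Or.inl ⟨d, hd, ?_, ?_⟩
      · have h0 : (d : ℕ) ≠ 0 := fun h0 => by simp [h0, hn, hq] at hd
        have h1 : (d : ℕ) ≠ 1 := fun h1 => by simp [h1] at hdn
        omega
      · have hd' : ((d : ℕ) : ℤ) ∣ n * q := by exact_mod_cast hd
        obtain ⟨w, hw⟩ := hd'
        rw [hbd]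
        exact ⟨w * ((y - 1) / q), by
          linear_combination hy - (n : ℤ) * hdiv + ((y - 1) / q) * hw⟩
    · refine Or.inr ⟨⟨(y - 1) / q + 1, ?_⟩, by change S.card < q; omega⟩
      have hsq' : (s : ℤ) + 1 = q := by
        change q ≤ S.card + 1 at hcard
        omega
      push_cast
      linear_combination hy - (n : ℤ) * hdiv + (n : ℤ) * hsq'

lemma almostCovers_one : AlmostCovers 1 :=
  ⟨0, 0, fun x => Or.inr (by simp)⟩

lemma AlmostCovers.mul_pow {m q : ℕ} (h : AlmostCovers m) (hm : m ≠ 0) (hq : q.Prime)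
    (hmq : m.Coprime q) (hcard : q ≤ m.divisors.card + 1) (e : ℕ) :
    AlmostCovers (m * q ^ e) := by
  induction e with
  | zero => simpa using h
  | succ e ih =>
    obtain ⟨a, r, ha⟩ := ih.exists_mul (mul_ne_zero hm (pow_ne_zero e hq.ne_zero)) hq.ne_zero
      (by rwa [card_newDivisors hm hq hmq])
    rw [pow_succ, ← mul_assoc]
    exact ⟨a, r, fun x => (ha x).imp_right And.left⟩

lemma AlmostCovers.isCoveringNumber_mul {m q : ℕ} (h : AlmostCovers m) (hm : m ≠ 0)
    (hq : q.Prime) (hmq : m.Coprime q) (hcard : q ≤ m.divisors.card) :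
    IsCoveringNumber (m * q) := by
  have hnew : (newDivisors m q).card = m.divisors.card := by
    simpa using card_newDivisors hm hq hmq 0
  obtain ⟨a, r, ha⟩ := h.exists_mul hm hq.ne_zero (by omega)
  exact (isCoveringNumber_iff (mul_ne_zero hm hq.ne_zero)).2
    ⟨a, fun x => (ha x).resolve_right fun hx => by omega⟩

lemma not_isCoveringNumber_one : ¬ IsCoveringNumber 1 := by
  rintro ⟨k, a, m, -, h1, hdvd, hcov⟩
  obtain ⟨i, -⟩ := hcov 0
  exact (h1 i).ne' (Nat.dvd_one.1 (hdvd i))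

lemma not_isCoveringNumber_mul_pow {m q : ℕ} (h : ¬ IsCoveringNumber m) (hm : m ≠ 0)
    (hq : q.Prime) (hmq : m.Coprime q) (hcard : m.divisors.card < q) (e : ℕ) :
    ¬ IsCoveringNumber (m * q ^ e) := by
  induction e with
  | zero => simpa using h
  | succ e ih =>
    have hne : m * q ^ e ≠ 0 := mul_ne_zero hm (pow_ne_zero e hq.ne_zero)
    rw [pow_succ, ← mul_assoc, isCoveringNumber_iff (mul_ne_zero hne hq.ne_zero)]
    rw [isCoveringNumber_iff hne] at ih
    push Not at ih ⊢
    exact fun a => exists_not_coversAt_mul hne hq (by rwa [card_newDivisors hm hq hmq]) (ih a)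

lemma card_divisors_mul_seven_pow {m : ℕ} (hm : m.Coprime 7) (k : ℕ) :
    (m * 7 ^ k).divisors.card = m.divisors.card * (k + 1) := by
  rw [(hm.pow_right k).card_divisors_mul, Nat.divisors_prime_pow (by norm_num), Finset.card_map,
    Finset.card_range]

lemma almostCovers_eighteen_mul_seven_pow (k : ℕ) : AlmostCovers (18 * 7 ^ k) := by
  have h2 : AlmostCovers 2 := by
    simpa using almostCovers_one.mul_pow one_ne_zero Nat.prime_two (by norm_num) (by simp) 1
  have h18 : AlmostCovers 18 := by
    simpa using h2.mul_pow two_ne_zero Nat.prime_three (by norm_num) (by decide) 2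
  exact h18.mul_pow (by norm_num) (by norm_num) (by norm_num) (by decide) k

lemma not_isCoveringNumber_eighteen_mul_seven_pow (k : ℕ) :
    ¬ IsCoveringNumber (18 * 7 ^ k) := by
  have h2 : ¬ IsCoveringNumber 2 := by
    simpa using not_isCoveringNumber_mul_pow not_isCoveringNumber_one one_ne_zero
      Nat.prime_two (by norm_num) (by simp) 1
  have h18 : ¬ IsCoveringNumber 18 := by
    simpa using not_isCoveringNumber_mul_pow h2 two_ne_zero Nat.prime_three (by norm_num)
      (by decide) 2
  exact not_isCoveringNumber_mul_pow h18 (by norm_num) (by norm_num) (by norm_num) (by decide) k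

lemma coprime_mul_seven_pow {c p : ℕ} (hc : c ∣ 18) (hp : p.Prime) (h7 : 7 < p) (k : ℕ) :
    (c * 7 ^ k).Coprime p := by
  have h (q : ℕ) (hq : q.Prime) (hqp : q < p) : q.Coprime p :=
    (Nat.coprime_primes hq hp).2 hqp.ne
  have h18 : Nat.Coprime (2 * 3 ^ 2) p :=
    (h 2 Nat.prime_two (by omega)).mul_left ((h 3 Nat.prime_three (by omega)).pow_left 2)
  exact (Nat.Coprime.coprime_dvd_left hc h18).mul_left ((h 7 (by norm_num) h7).pow_left k)

lemma not_isCoveringNumber_mul_seven_pow_mul_prime {c p k : ℕ} (hc : c ∣ 18) (hp : p.Prime)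
    (h7 : 7 < p) (hcard : c.divisors.card * (k + 1) < p) :
    ¬ IsCoveringNumber (c * 7 ^ k * p) := by
  have hc0 : c ≠ 0 := by
    rintro rfl
    norm_num at hc
  have hc7 : c.Coprime 7 := Nat.Coprime.coprime_dvd_left hc (by norm_num)
  have h : ¬ IsCoveringNumber (c * 7 ^ k) := fun h =>
    not_isCoveringNumber_eighteen_mul_seven_pow k (h.of_dvd (Nat.mul_dvd_mul_right hc _))
  simpa using not_isCoveringNumber_mul_pow h (by positivity) hp
    (coprime_mul_seven_pow hc hp h7 k) (by rwa [card_divisors_mul_seven_pow hc7]) 1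

theorem stmt10 (p : ℕ) (hp : p.Prime) (h7 : 7 < p) :
    IsPrimitiveCoveringNumber (2 * 3 ^ 2 * 7 ^ ((p - 1) / 6) * p) := by
  have h11 : 11 ≤ p := by
    by_contra! hlt
    interval_cases p <;> revert hp <;> decide
  obtain ⟨k, hk⟩ : ∃ k, (p - 1) / 6 = k + 1 := ⟨(p - 1) / 6 - 1, by omega⟩
  rw [hk, show 2 * 3 ^ 2 = 18 by norm_num]
  have card6 : (Nat.divisors 6).card = 4 := by decide
  have card9 : (Nat.divisors 9).card = 3 := by decide
  have card18 : (Nat.divisors 18).card = 6 := by decide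
  constructor
  · refine (almostCovers_eighteen_mul_seven_pow (k + 1)).isCoveringNumber_mul (by positivity) hp
      (coprime_mul_seven_pow dvd_rfl hp h7 _) ?_
    rw [card_divisors_mul_seven_pow (by norm_num), card18]
    omega
  · rintro d ⟨e, he⟩ hne hd
    have he1 : e ≠ 1 := by
      rintro rfl
      exact hne (by rw [he, mul_one])
    obtain ⟨q, hq, f, rfl⟩ := Nat.exists_prime_and_dvd he1
    have key {n : ℕ} (hn : 18 * 7 ^ (k + 1) * p = q * n) : IsCoveringNumber n := by
      refine hd.of_dvd ⟨f, Nat.eq_of_mul_eq_mul_left hq.pos ?_⟩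
      rw [← hn, he]
      ring
    have hqN : q ∣ 2 * 3 ^ 2 * 7 ^ (k + 1) * p := by
      norm_num
      rw [he]
      exact ⟨d * f, by ring⟩
    rw [hq.dvd_mul, hq.dvd_mul, hq.dvd_mul] at hqN
    rcases hqN with ((h | h) | h) | h
    · obtain rfl := (Nat.prime_dvd_prime_iff_eq hq Nat.prime_two).1 h
      exact not_isCoveringNumber_mul_seven_pow_mul_prime (c := 9) (k := k + 1) (by norm_num) hp h7
        (by rw [card9]; omega) (key (by ring))
    · obtain rfl := (Nat.prime_dvd_prime_iff_eq hq Nat.prime_three).1 (hq.dvd_of_dvd_pow h)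
      exact not_isCoveringNumber_mul_seven_pow_mul_prime (c := 6) (k := k + 1) (by norm_num) hp h7
        (by rw [card6]; omega) (key (by ring))
    · obtain rfl := (Nat.prime_dvd_prime_iff_eq hq (by norm_num)).1 (hq.dvd_of_dvd_pow h)
      exact not_isCoveringNumber_mul_seven_pow_mul_prime (c := 18) (k := k) dvd_rfl hp h7
        (by rw [card18]; omega) (key (by ring))
    · obtain rfl := (Nat.prime_dvd_prime_iff_eq hq hp).1 h
      exact not_isCoveringNumber_eighteen_mul_seven_pow (k + 1) (key (by ring))
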